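/- Suppose S = {0,1}^K, τ̂(s) = τ0 + Σ_{k=1}^K s_k δ_k, c(s) = c0 + Σ_{k=1}^K s_k Δc_k, with τ0 > c0 > 0 and c(s) ≥ 0 for all s ∈ S. Define e_k = Δc_k − δ_k, 𝒦⁺ = {k : e_k > 0}, order e_{π(1)} ≥ ⋯ ≥ e_{π(K⁺)} > 0, E_r = Σ_{j=1}^r e_{π(j)}, and m = min{r : E_r ≥ τ0 − c0} when it exists, with s_g activating exactly {π(1),…,π(m)}. Additionally assume Δc_k ≥ 0 for all k ∈ 𝒦⁺ and max_{k∈𝒦⁺} e_k ≤ 2c0. Then s_g automatically satisfies τ̂(s_g) ≥ −c(s_g); consequently, whenever m exists, s_g is null-compatible and ‖s_g‖₀ = MSP(S, N(S)) = m, and if no such m exists then MSP(S, N(S)) = ∞. -/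

import Mathlib

/-- Minimum specification perturbation: the least Hamming weight (cardinality)
of a feasible specification, or `⊤` if the feasible set is empty. -/
noncomputable def MSP {K : ℕ} (F : Set (Finset (Fin K))) : ℕ∞ :=
  ⨅ s ∈ F, (s.card : ℕ∞)

/-- Greedy prefix sum of effective shifts: `E r = ∑_{j=1}^r e_{π(j)}`
(with `π` zero-indexed). -/
def Esum {K : ℕ} (e : Fin K → ℝ) (π : ℕ → Fin K) (r : ℕ) : ℝ :=
  ∑ j ∈ Finset.range r, e (π j)

/-- For a function antitone below `n`, the sum over a subset of `range n` is at most the sum over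
the initial segment of the same cardinality. -/
theorem sum_le_sum_range_card_of_antitone (f : ℕ → ℝ) (n : ℕ)
    (hf : ∀ i j, i ≤ j → j < n → f j ≤ f i) (J : Finset ℕ) (hJ : ∀ j ∈ J, j < n) :
    ∑ j ∈ J, f j ≤ ∑ j ∈ Finset.range J.card, f j := by
  induction n generalizing J with
  | zero =>
    obtain rfl : J = ∅ := Finset.eq_empty_of_forall_notMem fun j hj => absurd (hJ j hj) (by omega)
    simp
  | succ n ih =>
    have hf' : ∀ i j, i ≤ j → j < n → f j ≤ f i := fun i j hij hj => hf i j hij (by omega)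
    have herase : ∀ j ∈ J.erase n, j < n := fun j hj => by
      have := hJ j (Finset.mem_of_mem_erase hj)
      have := Finset.ne_of_mem_erase hj
      omega
    have hsum := ih hf' (J.erase n) herase
    by_cases hn : n ∈ J
    · have hcard : (J.erase n).card ≤ n := by
        simpa using Finset.card_le_card (t := Finset.range n)
          fun j hj => Finset.mem_range.2 (herase j hj)
      rw [← Finset.card_erase_add_one hn, Finset.sum_range_succ, ← Finset.sum_erase_add J f hn]
      exact add_le_add hsum (hf _ _ hcard (by omega))
    · rwa [Finset.erase_eq_of_notMem hn] at hsum

/-- The total effective shift of any specification is dominated by a greedy prefix sum using at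
most as many components. -/
theorem exists_sum_le_Esum {K : ℕ} (e : Fin K → ℝ) (Kp : ℕ) (π : ℕ → Fin K)
    (hπinj : ∀ i j, i < Kp → j < Kp → π i = π j → i = j)
    (hπsurj : ∀ k : Fin K, 0 < e k → ∃ j, j < Kp ∧ π j = k)
    (hsort : ∀ i j, i ≤ j → j < Kp → e (π j) ≤ e (π i)) (s : Finset (Fin K)) :
    ∃ r, r ≤ s.card ∧ r ≤ Kp ∧ ∑ k ∈ s, e k ≤ Esum e π r := by
  classical
  set J := (Finset.range Kp).filter (fun j => π j ∈ s)
  have hJlt : ∀ j ∈ J, j < Kp := fun j hj => Finset.mem_range.1 (Finset.mem_filter.1 hj).1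
  have hinj : Set.InjOn π J := fun i hi j hj h => hπinj i j (hJlt i hi) (hJlt j hj) h
  have himage : J.image π ⊆ s :=
    Finset.image_subset_iff.2 fun j hj => (Finset.mem_filter.1 hj).2
  refine ⟨J.card, ?_, ?_, ?_⟩
  · rw [← Finset.card_image_of_injOn hinj]
    exact Finset.card_le_card himage
  · simpa using Finset.card_le_card (Finset.filter_subset (fun j => π j ∈ s) (Finset.range Kp))
  · calc ∑ k ∈ s, e k ≤ ∑ k ∈ J.image π, e k := by
          rw [← Finset.sum_sdiff himage]
          refine add_le_of_nonpos_left (Finset.sum_nonpos fun k hk => ?_)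
          obtain ⟨hks, hkJ⟩ := Finset.mem_sdiff.1 hk
          by_contra! hpos
          obtain ⟨j, hj, rfl⟩ := hπsurj k hpos
          exact hkJ (Finset.mem_image_of_mem π
            (Finset.mem_filter.2 ⟨Finset.mem_range.2 hj, hks⟩))
      _ = ∑ j ∈ J, e (π j) := Finset.sum_image hinj
      _ ≤ Esum e π J.card := sum_le_sum_range_card_of_antitone (fun j => e (π j)) Kp hsort J hJlt

/-- Automatic feasibility: under the variable-width additive model with
`τ0 > c0 > 0`, `c(s) ≥ 0`, effective shifts `e_k = Δc_k - δ_k`, and the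
structural conditions `Δc_k ≥ 0` for all `k ∈ 𝒦⁺` and `max_{k∈𝒦⁺} e_k ≤ 2c0`,
the greedy prefix configuration `s_g` automatically satisfies the lower-bound
condition `τ̂(s_g) ≥ -c(s_g)`; consequently, whenever a smallest `m` with
`E_m ≥ τ0 - c0` exists, `s_g` is null-compatible and
`‖s_g‖₀ = MSP(S,N(S)) = m`, and if no such `m` exists then `MSP(S,N(S)) = ∞`. -/
theorem automatic_feasibility {K : ℕ} (τ0 c0 : ℝ) (δ Δc : Fin K → ℝ)
    (hc0 : 0 < c0) (hτ : c0 < τ0)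
    (hcs : ∀ s : Finset (Fin K), 0 ≤ c0 + ∑ k ∈ s, Δc k)
    (e : Fin K → ℝ) (he : ∀ k, e k = Δc k - δ k)
    (Kp : ℕ) (hKp : Kp = (Finset.univ.filter (fun k => 0 < e k)).card)
    (π : ℕ → Fin K)
    (hπinj : ∀ i j, i < Kp → j < Kp → π i = π j → i = j)
    (hπmem : ∀ j, j < Kp → 0 < e (π j))
    (hπsurj : ∀ k : Fin K, 0 < e k → ∃ j, j < Kp ∧ π j = k)
    (hsort : ∀ i j, i ≤ j → j < Kp → e (π j) ≤ e (π i))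
    (hΔc : ∀ k, 0 < e k → 0 ≤ Δc k)
    (hstep : ∀ k, 0 < e k → e k ≤ 2 * c0) :
    (∀ m, 1 ≤ m → m ≤ Kp → τ0 - c0 ≤ Esum e π m →
      (∀ r, 1 ≤ r → r < m → Esum e π r < τ0 - c0) →
      (-(c0 + ∑ k ∈ Finset.image π (Finset.range m), Δc k) ≤
          τ0 + ∑ k ∈ Finset.image π (Finset.range m), δ k ∧
        Finset.image π (Finset.range m) ∈
          {s : Finset (Fin K) |
            -(c0 + ∑ k ∈ s, Δc k) ≤ τ0 + ∑ k ∈ s, δ k ∧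
              τ0 + ∑ k ∈ s, δ k ≤ c0 + ∑ k ∈ s, Δc k} ∧
        (Finset.image π (Finset.range m)).card = m ∧
        MSP {s : Finset (Fin K) |
            -(c0 + ∑ k ∈ s, Δc k) ≤ τ0 + ∑ k ∈ s, δ k ∧
              τ0 + ∑ k ∈ s, δ k ≤ c0 + ∑ k ∈ s, Δc k} = (m : ℕ∞))) ∧
    ((¬ ∃ m, 1 ≤ m ∧ m ≤ Kp ∧ τ0 - c0 ≤ Esum e π m) →
      MSP {s : Finset (Fin K) |
          -(c0 + ∑ k ∈ s, Δc k) ≤ τ0 + ∑ k ∈ s, δ k ∧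
            τ0 + ∑ k ∈ s, δ k ≤ c0 + ∑ k ∈ s, Δc k} = ⊤) := by
  have hsum : ∀ s : Finset (Fin K), ∑ k ∈ s, e k = ∑ k ∈ s, Δc k - ∑ k ∈ s, δ k := fun s => by
    simp only [he, Finset.sum_sub_distrib]
  have hprefix : ∀ s : Finset (Fin K), τ0 + ∑ k ∈ s, δ k ≤ c0 + ∑ k ∈ s, Δc k →
      ∃ r, 1 ≤ r ∧ r ≤ s.card ∧ r ≤ Kp ∧ τ0 - c0 ≤ Esum e π r := by
    intro s hs
    obtain ⟨r, hrs, hrK, hr⟩ := exists_sum_le_Esum e Kp π hπinj hπsurj hsort s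
    rw [hsum] at hr
    refine ⟨r, Nat.one_le_iff_ne_zero.2 ?_, hrs, hrK, by linarith⟩
    rintro rfl
    simp only [Esum, Finset.range_zero, Finset.sum_empty] at hr
    linarith
  refine ⟨fun m hm hmK hEm hmin => ?_, fun hnone => ?_⟩
  · have hinj : Set.InjOn π (Finset.range m) := fun i hi j hj h =>
      hπinj i j ((Finset.mem_range.1 hi).trans_le hmK) ((Finset.mem_range.1 hj).trans_le hmK) h
    have hcard : (Finset.image π (Finset.range m)).card = m := by
      rw [Finset.card_image_of_injOn hinj, Finset.card_range]
    have hE : ∑ k ∈ Finset.image π (Finset.range m), e k = Esum e π m := Finset.sum_image hinj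
    have hwidth : 0 ≤ ∑ k ∈ Finset.image π (Finset.range m), Δc k := by
      refine Finset.sum_nonneg fun k hk => ?_
      obtain ⟨j, hj, rfl⟩ := Finset.mem_image.1 hk
      exact hΔc _ (hπmem j ((Finset.mem_range.1 hj).trans_le hmK))
    have hovershoot : Esum e π m ≤ τ0 + c0 := by
      obtain ⟨n, rfl⟩ := Nat.exists_eq_add_of_le' hm
      have hlast := hstep _ (hπmem n (by omega))
      have hprev : Esum e π n ≤ τ0 - c0 := by
        rcases Nat.eq_zero_or_pos n with rfl | hn
        · simp only [Esum, Finset.range_zero, Finset.sum_empty]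
          linarith
        · exact (hmin n hn (by omega)).le
      have hsucc : Esum e π (n + 1) = Esum e π n + e (π n) := Finset.sum_range_succ _ _
      linarith
    rw [hsum] at hE
    have hlower : -(c0 + ∑ k ∈ Finset.image π (Finset.range m), Δc k) ≤
        τ0 + ∑ k ∈ Finset.image π (Finset.range m), δ k := by linarith
    have hupper : τ0 + ∑ k ∈ Finset.image π (Finset.range m), δ k ≤
        c0 + ∑ k ∈ Finset.image π (Finset.range m), Δc k := by linarith
    refine ⟨hlower, ⟨hlower, hupper⟩, hcard, le_antisymm ?_ ?_⟩
    · exact (iInf₂_le _ ⟨hlower, hupper⟩).trans_eq (congrArg _ hcard)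
    · refine le_iInf₂ fun s hs => ?_
      obtain ⟨r, hr, hrs, -, hEr⟩ := hprefix s hs.2
      have hmr : m ≤ r := by
        by_contra! hlt
        exact (hmin r hr hlt).not_ge hEr
      exact_mod_cast hmr.trans hrs
  · refine top_unique (le_iInf₂ fun s hs => ?_)
    obtain ⟨r, hr, -, hrK, hEr⟩ := hprefix s hs.2
    exact absurd ⟨r, hr, hrK, hEr⟩ hnone
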